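/- Let p ≥ 1/2 and define h(r) = (2p − 1)r² + 2p · r² E(r)/(E(r) − r'² K(r)) for r ∈ (0,1). Then h is strictly decreasing on (0,1), with limit 4p as r → 0⁺ and limit 4p − 1 as r → 1⁻ (so it maps (0,1) onto (4p − 1, 4p)), if and only if p ≤ 2. -/

import Mathlib

open Real Set Filter Topology

/-- The complete elliptic integral of the second kind. -/
noncomputable def ellipticE (r : ℝ) : ℝ :=
  ∫ θ in (0:ℝ)..(π/2), Real.sqrt (1 - r^2 * Real.sin θ ^ 2)

/-- The complete elliptic integral of the first kind. -/
noncomputable def ellipticK (r : ℝ) : ℝ :=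
  ∫ θ in (0:ℝ)..(π/2), (1 - r^2 * Real.sin θ ^ 2) ^ (-(1:ℝ)/2)


noncomputable def JJ (w : ℝ → ℝ) (a x : ℝ) : ℝ :=
  ∫ θ in (0:ℝ)..(π/2), w θ * (1 - x * Real.sin θ ^ 2) ^ a

lemma base_pos {x : ℝ} (hx : x < 1) (θ : ℝ) : 0 < 1 - x * Real.sin θ ^ 2 := by
  have h1 := Real.sin_sq_le_one θ
  rcases le_or_gt x 0 with h | h
  · nlinarith [sq_nonneg (Real.sin θ)]
  · nlinarith [sq_nonneg (Real.sin θ)]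

lemma JJ_cont {w : ℝ → ℝ} (hw : Continuous w) (a : ℝ) {x : ℝ} (hx : x < 1) :
    Continuous (fun θ => w θ * (1 - x * Real.sin θ ^ 2) ^ a) := by
  refine hw.mul (Continuous.rpow_const (by fun_prop) ?_)
  intro θ; exact Or.inl (base_pos hx θ).ne'

lemma JJ_deriv {w : ℝ → ℝ} (hw : Continuous w) (a : ℝ) {x : ℝ} (hx : x < 1) :
    HasDerivAt (JJ w a) (JJ (fun θ => -a * w θ * Real.sin θ ^ 2) (a-1) x) x := by
  have hcomp : IsCompact (Icc (x - (1-x)/2) (x + (1-x)/2) ×ˢ Icc (0:ℝ) (π/2)) :=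
    isCompact_Icc.prod isCompact_Icc
  have hc : ContinuousOn (fun q : ℝ × ℝ => -a * w q.2 * Real.sin q.2 ^ 2 *
      (1 - q.1 * Real.sin q.2 ^ 2) ^ (a-1)) (Icc (x - (1-x)/2) (x + (1-x)/2) ×ˢ Icc (0:ℝ) (π/2)) := by
    refine ContinuousOn.mul (by fun_prop) (ContinuousOn.rpow_const (by fun_prop) ?_)
    rintro ⟨y, θ⟩ ⟨⟨_, hy⟩, _⟩
    exact Or.inl (base_pos (by dsimp at hy; linarith) θ).ne'
  obtain ⟨C, hC⟩ := hcomp.exists_bound_of_continuousOn hc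
  have hpi := Real.pi_pos
  have := intervalIntegral.hasDerivAt_integral_of_dominated_loc_of_deriv_le
    (μ := MeasureTheory.volume) (a := 0) (b := π/2) (x₀ := x)
    (F := fun x θ => w θ * (1 - x * Real.sin θ ^ 2) ^ a)
    (F' := fun x θ => -a * w θ * Real.sin θ ^ 2 * (1 - x * Real.sin θ ^ 2) ^ (a-1))
    (s := Ioo (x - (1-x)/2) (x + (1-x)/2)) (bound := fun _ => C)
    (Ioo_mem_nhds (by linarith) (by linarith))
    (by
      filter_upwards [Iio_mem_nhds hx] with y hy
      exact (JJ_cont hw a hy).aestronglyMeasurable)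
    ((JJ_cont hw a hx).intervalIntegrable _ _)
    (by
      refine Continuous.aestronglyMeasurable ?_
      exact JJ_cont (w := fun θ => -a * w θ * Real.sin θ ^ 2) (by fun_prop) (a-1) hx)
    (by
      refine Eventually.of_forall fun θ hθ y hy => ?_
      rw [uIoc_of_le (by positivity)] at hθ
      exact hC (y, θ) ⟨⟨hy.1.le, hy.2.le⟩, ⟨hθ.1.le, hθ.2⟩⟩)
    (by simp)
    (by
      refine Eventually.of_forall fun θ hθ y hy => ?_
      have hy1 : y < 1 := by linarith [hy.2]
      have h1 : HasDerivAt (fun y : ℝ => 1 - y * Real.sin θ ^ 2) (-(Real.sin θ ^ 2)) y := by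
        simpa using ((hasDerivAt_id y).mul_const (Real.sin θ ^ 2)).const_sub 1
      have h2 := (h1.rpow_const (p := a) (Or.inl (base_pos hy1 θ).ne')).const_mul (w θ)
      exact h2.congr_deriv (by ring))
  exact this.2

/-- modulus-parameter versions -/
noncomputable def EE (x : ℝ) : ℝ := JJ (fun _ => 1) (1/2) x
noncomputable def KK (x : ℝ) : ℝ := JJ (fun _ => 1) (-1/2) x
noncomputable def BB (x : ℝ) : ℝ := JJ (fun θ => Real.cos θ ^ 2) (-1/2) x

lemma ellE (r : ℝ) : ellipticE r = EE (r^2) := by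
  simp [ellipticE, EE, JJ, Real.sqrt_eq_rpow]
lemma ellK (r : ℝ) : ellipticK r = KK (r^2) := by
  simp [ellipticK, KK, JJ]

lemma EE_eq {x : ℝ} (hx : x < 1) : EE x = (1-x) * KK x + x * BB x := by
  unfold EE KK BB JJ
  rw [← intervalIntegral.integral_const_mul, ← intervalIntegral.integral_const_mul,
    ← intervalIntegral.integral_add]
  · congr 1; ext θ
    have hb := base_pos hx θ
    have : (1 - x * Real.sin θ ^ 2) ^ (1/2:ℝ) =
        (1 - x * Real.sin θ ^ 2) * (1 - x * Real.sin θ ^ 2) ^ (-1/2:ℝ) := by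
      nth_rw 2 [← Real.rpow_one (1 - x * Real.sin θ ^ 2)]
      rw [← Real.rpow_add hb]; norm_num
    simp only [this, Real.cos_sq']; ring
  · exact (continuous_const.mul (JJ_cont continuous_const _ hx)).intervalIntegrable _ _
  · exact (continuous_const.mul (JJ_cont (by fun_prop) _ hx)).intervalIntegrable _ _

lemma EE_deriv {x : ℝ} (hx : x < 1) : HasDerivAt EE ((BB x - KK x)/2) x := by
  have h := JJ_deriv (w := fun _ => 1) continuous_const (1/2) hx
  refine h.congr_deriv ?_
  symm
  unfold KK BB JJ
  rw [← intervalIntegral.integral_sub, ← intervalIntegral.integral_div]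
  · congr 1; ext θ
    simp only [Real.cos_sq']
    norm_num; ring
  · exact (JJ_cont (by fun_prop) _ hx).intervalIntegrable _ _
  · exact (JJ_cont (by fun_prop) _ hx).intervalIntegrable _ _

lemma KK_deriv {x : ℝ} (hx : x < 1) (hx0 : x ≠ 0) : HasDerivAt KK (BB x / (2 * (1-x))) x := by
  have h := JJ_deriv (w := fun _ => 1) continuous_const (-1/2) hx
  refine h.congr_deriv ?_
  symm
  have key : JJ (fun _ => 1) (1/2) x - (1-x) * JJ (fun _ => 1) (-3/2) x = 0 := by
    have hF : ∀ θ ∈ uIcc (0:ℝ) (π/2), HasDerivAt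
        (fun θ => x * (Real.sin θ * Real.cos θ) * (1 - x * Real.sin θ ^ 2) ^ (-1/2:ℝ))
        (1 * (1 - x * Real.sin θ ^ 2) ^ (1/2:ℝ)
          - (1-x) * (1 * (1 - x * Real.sin θ ^ 2) ^ (-3/2:ℝ))) θ := by
      intro θ _
      have hb := base_pos hx θ
      have h1 : HasDerivAt (fun θ : ℝ => 1 - x * Real.sin θ ^ 2)
          (-(x * (2 * Real.sin θ * Real.cos θ))) θ := by
        have := (((Real.hasDerivAt_sin θ).pow 2).const_mul x).const_sub 1
        simpa using this
      have h2 := h1.rpow_const (p := (-1/2:ℝ)) (Or.inl hb.ne')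
      have h3 := (((Real.hasDerivAt_sin θ).mul (Real.hasDerivAt_cos θ)).const_mul x).mul h2
      refine h3.congr_deriv ?_
      symm
      have e1 : (1 - x * Real.sin θ ^ 2) ^ (1/2:ℝ) =
        (1 - x * Real.sin θ ^ 2)^2 * (1 - x * Real.sin θ ^ 2) ^ (-3/2:ℝ) := by
        rw [← Real.rpow_natCast (1 - x * Real.sin θ ^ 2) 2, ← Real.rpow_add hb]; norm_num
      have e2 : (1 - x * Real.sin θ ^ 2) ^ (-1/2:ℝ) =
        (1 - x * Real.sin θ ^ 2) * (1 - x * Real.sin θ ^ 2) ^ (-3/2:ℝ) := by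
        nth_rw 2 [← Real.rpow_one (1 - x * Real.sin θ ^ 2)]
        rw [← Real.rpow_add hb]; norm_num
      have e3 : (-1/2:ℝ) - 1 = -3/2 := by norm_num
      rw [e3, e1, e2]
      generalize (1 - x * Real.sin θ ^ 2) ^ (-3/2:ℝ) = z
      have hc := Real.cos_sq' θ
      simp only [Pi.mul_apply]
      linear_combination (-x * z*(1-x * Real.sin θ ^ 2) - x^2 * Real.sin θ^2 * z) * hc
    have i1 : IntervalIntegrable (fun θ => 1 * (1 - x * Real.sin θ ^ 2) ^ (1/2:ℝ))
        MeasureTheory.volume 0 (π/2) :=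
      (JJ_cont (w := fun _ => 1) continuous_const _ hx).intervalIntegrable _ _
    have i2 : IntervalIntegrable (fun θ => (1-x) * (1 * (1 - x * Real.sin θ ^ 2) ^ (-3/2:ℝ)))
        MeasureTheory.volume 0 (π/2) :=
      (continuous_const.mul
        (JJ_cont (w := fun _ => 1) continuous_const _ hx)).intervalIntegrable _ _
    have hi := intervalIntegral.integral_eq_sub_of_hasDerivAt hF (i1.sub i2)
    rw [intervalIntegral.integral_sub i1 i2, intervalIntegral.integral_const_mul] at hi
    simpa [JJ] using hi
  have k2 : x * JJ (fun θ => -(-1/2) * 1 * Real.sin θ ^ 2) (-1/2-1) x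
      = (JJ (fun _ => 1) (-3/2) x - KK x)/2 := by
    unfold KK JJ
    rw [← intervalIntegral.integral_const_mul, ← intervalIntegral.integral_sub,
      ← intervalIntegral.integral_div]
    · congr 1; ext θ
      have hb := base_pos hx θ
      have e2 : (1 - x * Real.sin θ ^ 2) ^ (-1/2:ℝ) =
        (1 - x * Real.sin θ ^ 2) * (1 - x * Real.sin θ ^ 2) ^ (-3/2:ℝ) := by
        nth_rw 2 [← Real.rpow_one (1 - x * Real.sin θ ^ 2)]
        rw [← Real.rpow_add hb]; norm_num
      have e3 : (-1/2:ℝ) - 1 = -3/2 := by norm_num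
      rw [e3, e2]; ring
    · exact (JJ_cont (by fun_prop) _ hx).intervalIntegrable _ _
    · exact (JJ_cont (by fun_prop) _ hx).intervalIntegrable _ _
  have k3 := EE_eq hx
  change EE x - _ = 0 at key
  have : (1-x) ≠ 0 := by linarith
  apply mul_left_cancel₀ hx0
  rw [k2]
  field_simp
  linarith

lemma KK_pos {x : ℝ} (hx : x < 1) : 0 < KK x := by
  unfold KK JJ
  apply intervalIntegral.intervalIntegral_pos_of_pos
  · exact (JJ_cont (by fun_prop) _ hx).intervalIntegrable _ _
  · intro θ; have := base_pos hx θ; positivity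
  · positivity

lemma BB_pos {x : ℝ} (hx : x < 1) : 0 < BB x := by
  unfold BB JJ
  apply intervalIntegral.intervalIntegral_pos_of_pos_on
  · exact (JJ_cont (by fun_prop) _ hx).intervalIntegrable _ _
  · intro θ hθ; have := base_pos hx θ
    have : 0 < Real.cos θ := Real.cos_pos_of_mem_Ioo ⟨by linarith [hθ.1, Real.pi_pos], hθ.2⟩
    positivity
  · positivity

lemma EE_zero : EE 0 = π/2 := by simp [EE, JJ]
lemma KK_zero : KK 0 = π/2 := by simp [KK, JJ]
lemma BB_zero : BB 0 = π/4 := by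
  simp [BB, JJ, integral_cos_sq]; ring
lemma BB_deriv_zero : HasDerivAt BB (π/32) 0 := by
  have h := JJ_deriv (w := fun θ => Real.cos θ ^ 2) (by fun_prop) (-1/2) (x := 0) one_pos
  refine h.congr_deriv ?_
  symm
  have : ∀ θ : ℝ, -(-1/2) * Real.cos θ ^ 2 * Real.sin θ ^ 2
     = (1/2) * (Real.sin θ ^ 2 * Real.cos θ ^ 2) := fun θ => by ring
  simp only [JJ, this, zero_mul, sub_zero, Real.one_rpow, mul_one]
  rw [intervalIntegral.integral_const_mul, integral_sin_sq_mul_cos_sq]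
  rw [show 4 * (π/2) = 2 * π by ring]
  simp; ring

lemma int_cos : ∫ θ in (0:ℝ)..(π/2), Real.cos θ = 1 := by simp

lemma cos_nn {θ : ℝ} (hθ : θ ∈ Set.uIoc (0:ℝ) (π/2)) : 0 ≤ Real.cos θ := by
  rw [uIoc_of_le (by positivity)] at hθ
  exact Real.cos_nonneg_of_mem_Icc ⟨by linarith [hθ.1, Real.pi_pos], hθ.2⟩

lemma ev01 : ∀ᶠ x : ℝ in 𝓝[<] 1, x ∈ Ioo (0:ℝ) 1 := Ioo_mem_nhdsLT one_pos

lemma base_le {x : ℝ} (hx : x ∈ Ioo (0:ℝ) 1) (θ : ℝ) :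
    (1 - x * Real.sin θ ^ 2) ^ (1/2:ℝ) ≤ 1 := by
  apply Real.rpow_le_one (base_pos hx.2 θ).le _ (by norm_num)
  nlinarith [hx.1, sq_nonneg (Real.sin θ)]

lemma EE_lim : Tendsto EE (𝓝[<] 1) (𝓝 1) := by
  suffices hs : Tendsto EE (𝓝[<] 1) (𝓝 (∫ θ in (0:ℝ)..(π/2), Real.cos θ)) by
    rwa [int_cos] at hs
  unfold EE JJ
  apply intervalIntegral.tendsto_integral_filter_of_dominated_convergence (fun _ => 1)
  · filter_upwards [ev01] with x hx
    exact (JJ_cont (w := fun _ => 1) continuous_const _ hx.2).aestronglyMeasurable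
  · filter_upwards [ev01] with x hx
    refine Eventually.of_forall fun θ hθ => ?_
    rw [one_mul, Real.norm_of_nonneg (Real.rpow_nonneg (base_pos hx.2 θ).le _)]
    exact base_le hx θ
  · simp
  · refine Eventually.of_forall fun θ hθ => ?_
    have hc := cos_nn hθ
    have : Real.cos θ = 1 * (1 - 1 * Real.sin θ ^ 2) ^ (1/2:ℝ) := by
      rw [one_mul, one_mul, ← Real.cos_sq', ← Real.sqrt_eq_rpow, Real.sqrt_sq hc]
    rw [this]
    apply tendsto_nhdsWithin_of_tendsto_nhds
    have : Continuous (fun x : ℝ => 1 * (1 - x * Real.sin θ ^ 2) ^ (1/2:ℝ)) :=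
      continuous_const.mul (Continuous.rpow_const (by fun_prop) (fun _ => Or.inr (by norm_num)))
    exact this.tendsto 1

lemma BB_lim : Tendsto BB (𝓝[<] 1) (𝓝 1) := by
  suffices hs : Tendsto BB (𝓝[<] 1) (𝓝 (∫ θ in (0:ℝ)..(π/2), Real.cos θ)) by
    rwa [int_cos] at hs
  unfold BB JJ
  apply intervalIntegral.tendsto_integral_filter_of_dominated_convergence (fun _ => 1)
  · filter_upwards [ev01] with x hx
    exact (JJ_cont (w := fun θ => Real.cos θ ^ 2) (by fun_prop) _ hx.2).aestronglyMeasurable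
  · filter_upwards [ev01] with x hx
    refine Eventually.of_forall fun θ hθ => ?_
    have hb := base_pos hx.2 θ
    rw [Real.norm_of_nonneg (by positivity)]
    have h1 : (1 - x * Real.sin θ ^ 2) ^ (1/2:ℝ) =
        (1 - x * Real.sin θ ^ 2) * (1 - x * Real.sin θ ^ 2) ^ (-1/2:ℝ) := by
      nth_rw 2 [← Real.rpow_one (1 - x * Real.sin θ ^ 2)]
      rw [← Real.rpow_add hb]; norm_num
    have h2 := base_le hx θ
    have h3 : Real.cos θ ^ 2 ≤ 1 - x * Real.sin θ ^ 2 := by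
      rw [Real.cos_sq']; nlinarith [hx.2, sq_nonneg (Real.sin θ)]
    have h4 := mul_le_mul_of_nonneg_right h3 (Real.rpow_nonneg hb.le (-1/2))
    linarith
  · simp
  · refine Eventually.of_forall fun θ hθ => ?_
    have hc := cos_nn hθ
    rcases hc.eq_or_lt with h | h
    · simp [← h]
    have : Real.cos θ = Real.cos θ ^ 2 * (1 - 1 * Real.sin θ ^ 2) ^ (-1/2:ℝ) := by
      rw [one_mul, ← Real.cos_sq', neg_div, Real.rpow_neg (by positivity),
        ← Real.sqrt_eq_rpow, Real.sqrt_sq hc]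
      field_simp
    rw [this]
    apply tendsto_nhdsWithin_of_tendsto_nhds
    have : ContinuousAt (fun x : ℝ => Real.cos θ ^ 2 * (1 - x * Real.sin θ ^ 2) ^ (-1/2:ℝ)) 1 := by
      refine continuousAt_const.mul (ContinuousAt.rpow_const (by fun_prop) (Or.inl ?_))
      rw [one_mul, ← Real.cos_sq']; positivity
    exact this.tendsto

lemma KK_cont {x : ℝ} (hx : x < 1) : ContinuousAt KK x :=
  (JJ_deriv (w := fun _ => 1) continuous_const (-1/2) hx).continuousAt

/-- the key upper bound E < (1 - x/2 - x²/16) K -/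
lemma key_bound {x : ℝ} (hx : x ∈ Ioo (0:ℝ) 1) : EE x < (1 - x/2 - x^2/16) * KK x := by
  set F : ℝ → ℝ := fun x => Real.exp (x/32 - 7/32 * Real.log (1-x)) *
    ((1 - x/2 - x^2/16) * KK x - EE x) with hF
  have hmono : StrictMonoOn F (Ico 0 1) := by
    apply strictMonoOn_of_deriv_pos (convex_Ico 0 1)
    · intro y hy
      have h1 := KK_cont hy.2
      have h2 := (EE_deriv hy.2).continuousAt
      have h3 : (1 - y) ≠ 0 := by linarith [hy.2]
      apply ContinuousAt.continuousWithinAt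
      refine ContinuousAt.mul ?_ ((ContinuousAt.mul (by fun_prop) h1).sub h2)
      have : ContinuousAt (fun x : ℝ => Real.log (1-x)) y :=
        ContinuousAt.log (by fun_prop) h3
      fun_prop
    · intro y hy
      rw [interior_Ico] at hy
      have h3 : (1 - y) ≠ 0 := by linarith [hy.2]
      have d1 := KK_deriv hy.2 hy.1.ne'
      have d2 := EE_deriv hy.2
      have dR : HasDerivAt (fun x : ℝ => 1 - x/2 - x^2/16) (-1/2 - y/8) y := by
        have := (((hasDerivAt_id y).div_const 2).const_sub 1).sub
          (((hasDerivAt_id y).pow 2).div_const 16)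
        refine this.congr_deriv ?_
        simp; ring
      have dl : HasDerivAt (fun x : ℝ => x/32 - 7/32 * Real.log (1-x))
          (1/32 - 7/32 * (-1/(1-y))) y := by
        have := (((hasDerivAt_id y).const_sub 1).log h3).const_mul (7/32)
        exact ((hasDerivAt_id y).div_const 32).sub this
      have d := dl.exp.mul ((dR.mul d1).sub d2)
      have hd := d.deriv
      change deriv F y = _ at hd
      rw [hd]
      have hK := KK_pos hy.2
      have hE := EE_eq hy.2
      have : 0 < Real.exp (y/32 - 7/32 * Real.log (1-y)) *
          (KK y * y^2 * (3/16 + y/256) / (2 * (1-y))) := by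
        have := hy.1
        have : 0 < 1 - y := by linarith [hy.2]
        positivity
      refine this.trans_eq ?_
      simp only [Pi.mul_apply, Pi.sub_apply]
      rw [hE]
      field_simp
      ring
  have h0 := hmono (left_mem_Ico.2 one_pos) (Ioo_subset_Ico_self hx) hx.1
  have : F 0 = 0 := by simp [hF, EE_zero, KK_zero]
  rw [this] at h0
  have := (pos_iff_pos_of_mul_pos h0).1 (Real.exp_pos _)
  linarith

lemma quad_neg {x E K : ℝ} (hx : x ∈ Ioo (0:ℝ) 1) (hK : 0 < K) (h1 : (1-x) * K < E)
    (h2 : E < (1 - x/2 - x^2/16) * K) :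
    9*E^2 - (14-10*x)*(E*K) + (1-x)*(5-3*x)*K^2 < 0 := by
  obtain ⟨hx0, hx1⟩ := hx
  set R := 1 - x/2 - x^2/16 with hR
  have hRy : 0 < R - (1-x) := by rw [hR]; nlinarith
  have a1 : 0 < (E - (1-x)*K) := by linarith
  have a2 : 0 < R*K - E := by linarith
  have qy : 2*(1-x)^2 - 2*(1-x) < 0 := by nlinarith
  have qR : x^3*(9*x-16)/256 < 0 := by
    have : 0 < x^3 := by positivity
    nlinarith
  have id1 : (R - (1-x)) * (9*E^2 - (14-10*x)*(E*K) + (1-x)*(5-3*x)*K^2)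
     = -9 * (R-(1-x)) * ((E - (1-x)*K) * (R*K - E)) + K * ((2*(1-x)^2 - 2*(1-x)) * (R*K-E)
       + (x^3*(9*x-16)/256) * (E - (1-x)*K)) := by
    rw [hR]; ring
  have t1 : 0 < 9 * (R-(1-x)) * ((E - (1-x)*K) * (R*K - E)) := by positivity
  have t2 := mul_neg_of_neg_of_pos qy a2
  have t3 := mul_neg_of_neg_of_pos qR a1
  have t4 := mul_neg_of_pos_of_neg hK (add_neg t2 t3)
  by_contra hcon
  have := mul_nonneg hRy.le (not_lt.1 hcon)
  linarith

lemma g_anti : StrictAntiOn (fun x => EE x / BB x + 3/4 * x) (Ioo 0 1) := by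
  have hD : ∀ x ∈ Ioo (0:ℝ) 1, HasDerivAt (fun x => x * EE x / (EE x - (1-x) * KK x) + 3/4*x)
     ((9*EE x^2 - (14-10*x)*(EE x*KK x) + (1-x)*(5-3*x)*KK x^2)
       / (4 * (EE x - (1-x) * KK x)^2)) x := by
    intro x hx
    have d1 := KK_deriv hx.2 hx.1.ne'
    have d2 := EE_deriv hx.2
    have hE := EE_eq hx.2
    have hB := BB_pos hx.2
    have hx0 := hx.1
    have h3 : (1 - x) ≠ 0 := by linarith [hx.2]
    have hBE : BB x = (EE x - (1-x) * KK x)/x := by rw [hE]; field_simp; ring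
    have hne : EE x - (1-x) * KK x ≠ 0 := by
      rw [hE]; ring_nf; positivity
    have d3 := d2.sub (((hasDerivAt_id x).const_sub 1).mul d1)
    have d := (((hasDerivAt_id x).mul d2).div d3 hne).add ((hasDerivAt_id x).const_mul (3/4))
    refine d.congr_deriv ?_
    simp only [Pi.mul_apply, Pi.sub_apply, id]
    rw [hBE]
    field_simp
    ring
  have h1 : StrictAntiOn (fun x => x * EE x / (EE x - (1-x) * KK x) + 3/4*x) (Ioo 0 1) := by
    apply strictAntiOn_of_deriv_neg (convex_Ioo 0 1)
    · intro x hx; exact (hD x hx).continuousAt.continuousWithinAt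
    · intro x hx
      rw [interior_Ioo] at hx
      rw [(hD x hx).deriv]
      have hE := EE_eq hx.2
      have hB := mul_pos hx.1 (BB_pos hx.2)
      apply div_neg_of_neg_of_pos
      · exact quad_neg hx (KK_pos hx.2) (by linarith) (key_bound hx)
      · have : 0 < EE x - (1-x) * KK x := by linarith
        positivity
  refine h1.congr ?_
  intro x hx
  have hx0 := hx.1
  have hB := BB_pos hx.2
  have : EE x - (1-x) * KK x = x * BB x := by rw [EE_eq hx.2]; ring
  simp only [this]
  field_simp

lemma h_eq (p : ℝ) {r : ℝ} (hr : r ∈ Ioo (0:ℝ) 1) : (2*p - 1) * r^2 +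
          2*p * (r^2 * ellipticE r / (ellipticE r - (1 - r^2) * ellipticK r))
     = (2*p-1) * r^2 + 2*p*(EE (r^2) / BB (r^2)) := by
  have h0 : 0 < r^2 := pow_pos hr.1 2
  have h1 : r^2 < 1 := by nlinarith [hr.1, hr.2]
  have hB := BB_pos h1
  rw [ellE, ellK]
  have : EE (r^2) - (1-r^2) * KK (r^2) = r^2 * BB (r^2) := by rw [EE_eq h1]; ring
  rw [this, mul_div_mul_left _ _ h0.ne']

lemma exists_big {q : ℝ} (hq : 3/4 < q) : ∃ x ∈ Ioo (0:ℝ) 1, 2 < EE x / BB x + q * x := by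
  have d : HasDerivAt (fun x => EE x - 2 * BB x + q * (x * BB x)) (π/4 * (q - 3/4)) 0 := by
    have := ((EE_deriv one_pos).sub (BB_deriv_zero.const_mul 2)).add
      (((hasDerivAt_id 0).mul BB_deriv_zero).const_mul q)
    refine this.congr_deriv ?_
    simp only [BB_zero, KK_zero, id]; ring
  have hpos : 0 < π/4 * (q - 3/4) := mul_pos (by positivity) (by linarith)
  have ht := hasDerivAt_iff_tendsto_slope.1 d
  have ht2 := ht.mono_left (nhdsWithin_mono 0 (fun x (hx : 0 < x) => hx.ne') : 𝓝[>] (0:ℝ) ≤ _)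
  have e1 := ht2.eventually (lt_mem_nhds hpos)
  have e2 : ∀ᶠ x : ℝ in 𝓝[>] 0, x ∈ Ioo (0:ℝ) 1 := Ioo_mem_nhdsGT one_pos
  obtain ⟨x, hx1, hx⟩ := (e1.and e2).exists
  refine ⟨x, hx, ?_⟩
  have hB := BB_pos hx.2
  rw [slope_def_field, EE_zero, BB_zero] at hx1
  have hx0 : 0 < x - 0 := by linarith [hx.1]
  have := (div_pos_iff_of_pos_right hx0).1 hx1
  have h2 : EE x / BB x + q * x - 2 = (EE x - 2 * BB x + q * (x * BB x)) / BB x := by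
    field_simp; ring
  have : 0 < EE x / BB x + q * x - 2 := by
    rw [h2]; apply div_pos _ hB; linarith
  linarith
/-- Lemma 2.4: for p ≥ 1/2, h(r) = (2p−1)r² + 2p·r²E(r)/(E(r) − r'²K(r)) is strictly
decreasing from (0,1) onto (4p−1, 4p) if and only if p ≤ 2. -/
theorem stmt_10 (p : ℝ) (hp : 1/2 ≤ p) :
    (StrictAntiOn
        (fun r : ℝ => (2*p - 1) * r^2 +
          2*p * (r^2 * ellipticE r / (ellipticE r - (1 - r^2) * ellipticK r))) (Ioo 0 1) ∧
      Tendsto (fun r : ℝ => (2*p - 1) * r^2 +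
          2*p * (r^2 * ellipticE r / (ellipticE r - (1 - r^2) * ellipticK r)))
        (𝓝[>] 0) (𝓝 (4*p)) ∧
      Tendsto (fun r : ℝ => (2*p - 1) * r^2 +
          2*p * (r^2 * ellipticE r / (ellipticE r - (1 - r^2) * ellipticK r)))
        (𝓝[<] 1) (𝓝 (4*p - 1))) ↔ p ≤ 2 := by

  constructor
  · rintro ⟨hanti, h0, -⟩
    by_contra hcon
    have hp2 : 2 < p := not_le.1 hcon
    have hp0 : 0 < 2 * p := by linarith
    have hq : 3/4 < (2*p-1)/(2*p) := by
      rw [lt_div_iff₀ hp0]; linarith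
    obtain ⟨x, hx, hbig⟩ := exists_big hq
    have hr : Real.sqrt x ∈ Ioo (0:ℝ) 1 :=
      ⟨Real.sqrt_pos.2 hx.1, by rw [Real.sqrt_lt' one_pos]; simpa using hx.2⟩
    have hle := ge_of_tendsto h0 (b := (2*p - 1) * (Real.sqrt x)^2 +
          2*p * ((Real.sqrt x)^2 * ellipticE (Real.sqrt x) /
            (ellipticE (Real.sqrt x) - (1 - (Real.sqrt x)^2) * ellipticK (Real.sqrt x)))) (by
      filter_upwards [Ioo_mem_nhdsGT hr.1] with s hs
      exact (hanti ⟨hs.1, hs.2.trans hr.2⟩ hr hs.2).le)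
    rw [h_eq p hr, Real.sq_sqrt hx.1.le] at hle
    have h2 := mul_lt_mul_of_pos_left hbig hp0
    have h3 : 2*p * (EE x / BB x + (2*p-1)/(2*p) * x) = (2*p-1)*x + 2*p*(EE x / BB x) := by
      field_simp; ring
    linarith
  · intro hp2
    refine ⟨?_, ?_, ?_⟩
    · intro r hr s hs hrs
      simp only [h_eq p hr, h_eq p hs]
      have hr2 : r^2 ∈ Ioo (0:ℝ) 1 := ⟨pow_pos hr.1 2, by nlinarith [hr.1, hr.2]⟩
      have hs2 : s^2 ∈ Ioo (0:ℝ) 1 := ⟨pow_pos hs.1 2, by nlinarith [hs.1, hs.2]⟩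
      have hlt : r^2 < s^2 := by nlinarith [hr.1]
      have h := g_anti hr2 hs2 hlt
      simp only at h
      have h2 := mul_lt_mul_of_pos_left h (show 0 < 2*p by linarith)
      nlinarith
    · have hE : ContinuousAt EE ((0:ℝ)^2) := by
        simpa using (EE_deriv one_pos).continuousAt
      have hB : ContinuousAt BB ((0:ℝ)^2) := by simpa using BB_deriv_zero.continuousAt
      have hsq : ContinuousAt (fun r : ℝ => r^2) 0 := by fun_prop
      have hc : ContinuousAt (fun r : ℝ => (2*p-1) * r^2 + 2*p*(EE (r^2) / BB (r^2))) 0 := by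
        have hE' : ContinuousAt (fun r : ℝ => EE (r^2)) 0 :=
          ContinuousAt.comp (f := fun r : ℝ => r^2) hE hsq
        have hB' : ContinuousAt (fun r : ℝ => BB (r^2)) 0 :=
          ContinuousAt.comp (f := fun r : ℝ => r^2) hB hsq
        have hne : BB ((0:ℝ)^2) ≠ 0 := (BB_pos (by norm_num)).ne'
        exact (continuousAt_const.mul hsq).add (continuousAt_const.mul (hE'.div hB' hne))
      have ht := hc.tendsto.mono_left (nhdsWithin_le_nhds (s := Ioi 0))
      have hv : (2*p-1) * (0:ℝ)^2 + 2*p*(EE ((0:ℝ)^2) / BB ((0:ℝ)^2)) = 4*p := by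
        have := Real.pi_ne_zero
        simp only [ne_eq, OfNat.ofNat_ne_zero, not_false_eq_true, zero_pow, EE_zero, BB_zero]
        field_simp; ring
      rw [hv] at ht
      refine ht.congr' ?_
      filter_upwards [Ioo_mem_nhdsGT one_pos] with r hr
      exact (h_eq p hr).symm
    · have hsq : Tendsto (fun r : ℝ => r^2) (𝓝[<] 1) (𝓝[<] 1) := by
        apply tendsto_nhdsWithin_of_tendsto_nhds_of_eventually_within
        · have : Continuous (fun r : ℝ => r^2) := by fun_prop
          simpa using (this.tendsto 1).mono_left (nhdsWithin_le_nhds (s := Iio 1))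
        · filter_upwards [ev01] with r hr
          simp only [mem_Iio]; nlinarith [hr.1, hr.2]
      have ht := ((hsq.mono_right nhdsWithin_le_nhds).const_mul (2*p-1)).add
        (((EE_lim.comp hsq).div (BB_lim.comp hsq) one_ne_zero).const_mul (2*p))
      have hv : (2*p-1) * 1 + 2*p*(1/1) = 4*p - 1 := by ring
      rw [hv] at ht
      refine ht.congr' ?_
      filter_upwards [ev01] with r hr
      exact (h_eq p hr).symm
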